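/- Let H be a K×M complex matrix of rank K, α ≥ 0, σ > 0, d = tr(HH_α)/K where H_α = H†(αI+HH†)^{-1}, and T with T†T = d²I_K − 2d·HH_α + HH_α H_MMSE⁺ H_α. Then for every z ∈ ℂ^K: ‖(HH_α − d·I_K)z‖² + σ²‖H_α z‖² = ‖T z‖². -/

import Mathlib

open Matrix

/-- Moore–Penrose pseudo-inverse of a full-column-rank matrix. -/
noncomputable def pinv {M K : ℕ} (A : Matrix (Fin M) (Fin K) ℂ) : Matrix (Fin K) (Fin M) ℂ :=
  (Aᴴ * A)⁻¹ * Aᴴ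

open scoped ComplexOrder

theorem nsq_aux {m n : ℕ} (A : Matrix (Fin m) (Fin n) ℂ) (z : Fin n → ℂ) :
    ((∑ i, ‖(A.mulVec z) i‖ ^ 2 : ℝ) : ℂ) = star z ⬝ᵥ ((Aᴴ * A) *ᵥ z) := by
  rw [← Matrix.mulVec_mulVec, Matrix.dotProduct_mulVec, ← Matrix.star_mulVec]
  simp only [dotProduct, Pi.star_apply, Complex.ofReal_sum]
  refine Finset.sum_congr rfl fun i _ => ?_
  rw [Complex.star_def, Complex.conj_mul']
  push_cast
  rfl

theorem stmt7 (K M : ℕ) (H : Matrix (Fin K) (Fin M) ℂ) (hrank : H.rank = K)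
    (α : ℝ) (hα : 0 ≤ α) (σ : ℝ) (hσ : 0 < σ)
    (Hα : Matrix (Fin M) (Fin K) ℂ)
    (hHα : Hα = Hᴴ * ((α : ℂ) • (1 : Matrix (Fin K) (Fin K) ℂ) + H * Hᴴ)⁻¹)
    (HM : Matrix (Fin M) (Fin K) ℂ)
    (hHM : HM = Hᴴ * (((σ ^ 2 : ℝ) : ℂ) • (1 : Matrix (Fin K) (Fin K) ℂ) + H * Hᴴ)⁻¹)
    (d : ℝ) (hd : (d : ℂ) = Matrix.trace (H * Hα) / K)
    (T : Matrix (Fin K) (Fin K) ℂ)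
    (hT : Tᴴ * T = ((d : ℂ) ^ 2) • (1 : Matrix (Fin K) (Fin K) ℂ)
        - (2 * (d : ℂ)) • (H * Hα) + H * Hα * pinv HM * Hα) :
    ∀ z : Fin K → ℂ,
      (∑ i, ‖((H * Hα - (d : ℂ) • (1 : Matrix (Fin K) (Fin K) ℂ)).mulVec z) i‖ ^ 2)
        + σ ^ 2 * ∑ j, ‖(Hα.mulVec z) j‖ ^ 2
      = ∑ i, ‖(T.mulVec z) i‖ ^ 2 := by
  intro z
  set G := H * Hᴴ with hG
  have hGs : G.PosSemidef := Matrix.posSemidef_self_mul_conjTranspose H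
  have hGu : IsUnit G := by
    have hr : G.rank = K := by rw [hG, Matrix.rank_self_mul_conjTranspose, hrank]
    rw [← Matrix.mulVec_surjective_iff_isUnit]
    have : LinearMap.range G.mulVecLin = ⊤ := by
      apply Submodule.eq_top_of_finrank_eq
      rw [← Matrix.rank, hr]; simp
    exact LinearMap.range_eq_top.mp this
  have hGp : G.PosDef := (hGs.posDef_iff_isUnit).mpr hGu
  have key : ∀ a : ℝ, 0 ≤ a → ((a : ℂ) • (1 : Matrix (Fin K) (Fin K) ℂ) + G).PosDef := by
    intro a ha
    refine Matrix.PosDef.posSemidef_add ?_ hGp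
    exact Matrix.PosSemidef.one.smul (by exact_mod_cast ha)
  have hA := key α hα
  have hB := key (σ^2) (by positivity)
  set A := (α : ℂ) • (1 : Matrix (Fin K) (Fin K) ℂ) + G with hAd
  set B := ((σ ^ 2 : ℝ) : ℂ) • (1 : Matrix (Fin K) (Fin K) ℂ) + G with hBd
  have uA : IsUnit A.det := (Matrix.isUnit_iff_isUnit_det _).mp hA.isUnit
  have uB : IsUnit B.det := (Matrix.isUnit_iff_isUnit_det _).mp hB.isUnit
  have uG : IsUnit G.det := (Matrix.isUnit_iff_isUnit_det _).mp hGu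
  have hAi : (A⁻¹)ᴴ = A⁻¹ := by rw [Matrix.conjTranspose_nonsing_inv, hA.1.eq]
  have hBi : (B⁻¹)ᴴ = B⁻¹ := by rw [Matrix.conjTranspose_nonsing_inv, hB.1.eq]
  have hGh : Gᴴ = G := hGp.1.eq
  have cGA : G * A = A * G := by rw [hAd]; simp [mul_add, add_mul]
  have cGAi : A⁻¹ * G = G * A⁻¹ := by
    calc A⁻¹ * G = A⁻¹ * (G * A) * A⁻¹ := by
          rw [mul_assoc, mul_assoc, Matrix.mul_nonsing_inv _ uA, mul_one]
      _ = G * A⁻¹ := by rw [cGA, ← mul_assoc, Matrix.nonsing_inv_mul _ uA, one_mul]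
  have hP : H * Hα = G * A⁻¹ := by rw [hHα, ← Matrix.mul_assoc]
  have hPi : pinv HM * Hα = B * A⁻¹ := by
    have h1 : HMᴴ * HM = B⁻¹ * G * B⁻¹ := by
      rw [hHM, Matrix.conjTranspose_mul, hBi, Matrix.conjTranspose_conjTranspose, hG]
      simp only [Matrix.mul_assoc]
    have h2 : HMᴴ * Hα = B⁻¹ * G * A⁻¹ := by
      rw [hHM, hHα, Matrix.conjTranspose_mul, hBi, Matrix.conjTranspose_conjTranspose, hG]
      simp only [Matrix.mul_assoc]
    rw [pinv, Matrix.mul_assoc, h1, h2, Matrix.mul_inv_rev, Matrix.mul_inv_rev,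
      Matrix.nonsing_inv_nonsing_inv _ uB]
    calc B * (G⁻¹ * B) * (B⁻¹ * G * A⁻¹) = B * (G⁻¹ * (B * B⁻¹) * G) * A⁻¹ := by
          simp only [mul_assoc]
      _ = _ := by rw [Matrix.mul_nonsing_inv _ uB, mul_one, Matrix.nonsing_inv_mul _ uG, mul_one]
  have hHH : Hαᴴ * Hα = G * A⁻¹ * A⁻¹ := by
    rw [← cGAi, hHα, Matrix.conjTranspose_mul, hAi, Matrix.conjTranspose_conjTranspose, hG]
    simp only [Matrix.mul_assoc]
  have hPh : (H * Hα - (d : ℂ) • (1 : Matrix (Fin K) (Fin K) ℂ))ᴴ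
      = G * A⁻¹ - (d : ℂ) • (1 : Matrix (Fin K) (Fin K) ℂ) := by
    rw [hP, Matrix.conjTranspose_sub, Matrix.conjTranspose_mul, hAi, hGh, cGAi,
      Matrix.conjTranspose_smul]
    simp
  have main : (H * Hα - (d : ℂ) • (1 : Matrix (Fin K) (Fin K) ℂ))ᴴ
      * (H * Hα - (d : ℂ) • (1 : Matrix (Fin K) (Fin K) ℂ))
      + ((σ ^ 2 : ℝ) : ℂ) • (Hαᴴ * Hα) = Tᴴ * T := by
    have e : G * A⁻¹ * (B * A⁻¹)
        = G * A⁻¹ * (G * A⁻¹) + ((σ ^ 2 : ℝ) : ℂ) • (G * A⁻¹ * A⁻¹) := by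
      rw [hBd, add_mul, mul_add, add_comm, smul_mul_assoc, one_mul, mul_smul_comm]
    rw [hT, hPh, Matrix.mul_assoc (H * Hα), hPi, hP, e, hHH]
    simp only [sub_mul, mul_sub, smul_mul_assoc, mul_smul_comm, one_mul, mul_one]
    module
  have := congrArg (fun X => star z ⬝ᵥ (X *ᵥ z)) main
  simp only [Matrix.add_mulVec, Matrix.smul_mulVec, dotProduct_add, dotProduct_smul,
    ← nsq_aux, smul_eq_mul] at this
  exact_mod_cast this
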